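/- arXiv:1605.00156 — 7 statements merged into one kernel-verified Lean document; each statement's English description precedes it below -/
import Mathlib

section
/- With the test functions C = B + (τ/2)·curl E, F = E + (τ/2)·grad p and q = p, the bilinear form of the time-discretized Maxwell auxiliary problem satisfies the coercivity bound a(B, E, p; C, F, q) ≥ (1/2)·(‖B‖_div² + ‖E‖_curl² + ‖p‖_grad²) for all B ∈ V_B, E ∈ V_E, p ∈ V_p. -/
open RealInnerProductSpace

/-- The quadratic form `τ⁻¹ ‖x + (τ / 2) • y‖²`, expanded, is nonnegative. -/
theorem inv_mul_norm_sq_add_inner_add_nonneg {V : Type*} [NormedAddCommGroup V]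
    [InnerProductSpace ℝ V] {τ : ℝ} (hτ : 0 < τ) (x y : V) :
    0 ≤ (1 / τ) * ‖x‖ ^ 2 + ⟪x, y⟫ + (τ / 4) * ‖y‖ ^ 2 := by
  have h : (1 / τ) * ‖x‖ ^ 2 + ⟪x, y⟫ + (τ / 4) * ‖y‖ ^ 2
      = (1 / τ) * ‖x + (τ / 2) • y‖ ^ 2 := by
    rw [norm_add_sq_real, inner_smul_right, norm_smul, mul_pow, Real.norm_eq_abs, sq_abs]
    field_simp
    ring
  rw [h]
  positivity

/-- Coercivity of the bilinear form of the time-discretized Maxwell auxiliary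
problem with the test functions `C = B + (τ/2) • curl E`,
`F = E + (τ/2) • grad p`, `q = p`. -/
theorem maxwell_aux_coercivity
    {VB VE VP L : Type*}
    [NormedAddCommGroup VB] [InnerProductSpace ℝ VB] [FiniteDimensional ℝ VB]
    [NormedAddCommGroup VE] [InnerProductSpace ℝ VE] [FiniteDimensional ℝ VE]
    [NormedAddCommGroup VP] [InnerProductSpace ℝ VP] [FiniteDimensional ℝ VP]
    [NormedAddCommGroup L] [InnerProductSpace ℝ L] [FiniteDimensional ℝ L]
    (curl : VE →ₗ[ℝ] VB) (grad : VP →ₗ[ℝ] VE) (dvg : VB →ₗ[ℝ] L)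
    (hcg : ∀ p : VP, curl (grad p) = 0)
    (hdc : ∀ E : VE, dvg (curl E) = 0)
    (z : VE →ₗ[ℝ] VE →ₗ[ℝ] ℝ)
    (hzsym : ∀ u v : VE, z u v = z v u)
    (hzpsd : ∀ u : VE, 0 ≤ z u u)
    (hzg : ∀ (E : VE) (p : VP), z E (grad p) = 0)
    (τ γ : ℝ) (hτ : 0 < τ) (hγ : 0 ≤ 1 + γ)
    (B : VB) (E : VE) (p : VP)
    (C : VB) (F : VE) (q : VP)
    (hC : C = B + (τ / 2) • curl E)
    (hF : F = E + (τ / 2) • grad p)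
    (hq : q = p) :
    (2 / τ) * ⟪B, C⟫ + ⟪curl E, C⟫ + ⟪dvg B, dvg C⟫
      + (2 / τ) * ⟪E, F⟫ + ⟪grad p, F⟫ - ⟪B, curl F⟫ + (1 + γ) * z E F
      + (2 / τ) * ⟪p, q⟫ - ⟪E, grad q⟫
    ≥ (1 / 2) * (((2 / τ) * ‖B‖ ^ 2 + ‖dvg B‖ ^ 2)
        + ((2 / τ) * ‖E‖ ^ 2 + (τ / 2) * ‖curl E‖ ^ 2 + (1 + γ) * z E E)
        + ((2 / τ) * ‖p‖ ^ 2 + (τ / 2) * ‖grad p‖ ^ 2)) := by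
  subst hC hF hq
  have hB := inv_mul_norm_sq_add_inner_add_nonneg hτ B (curl E)
  have hE := inv_mul_norm_sq_add_inner_add_nonneg hτ E (grad q)
  have hz := mul_nonneg hγ (hzpsd E)
  have hp : 0 ≤ (2 / τ) * ‖q‖ ^ 2 := by positivity
  have hd := sq_nonneg ‖dvg B‖
  have hτ2 : 2 / τ * (τ / 2) = 1 := by field_simp
  simp only [map_add, map_smul, hcg, hdc, hzg, smul_zero, add_zero, inner_add_right,
    inner_smul_right, real_inner_self_eq_norm_sq, mul_add, ← mul_assoc, hτ2, one_mul,
    real_inner_comm B (curl E), real_inner_comm E (grad q)]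
  simp only [div_eq_mul_inv] at *
  linarith
end

section
/- With the test functions C = B + (τ/2)·curl E, F = E + (τ/2)·grad p and q = p, one has the stability bound ‖C‖_div² + ‖F‖_curl² + ‖q‖_grad² ≤ 4·(‖B‖_div² + ‖E‖_curl² + ‖p‖_grad²) for all B ∈ V_B, E ∈ V_E, p ∈ V_p. -/
open RealInnerProductSpace

/-- Weighted parallelogram bound: `(2/τ) ‖x + (τ/2) y‖² ≤ 2 ((2/τ) ‖x‖² + (τ/2) ‖y‖²)`. -/
theorem two_div_mul_norm_add_smul_sq_le {V : Type*} [NormedAddCommGroup V] [InnerProductSpace ℝ V]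
    {τ : ℝ} (hτ : 0 < τ) (x y : V) :
    (2 / τ) * ‖x + (τ / 2) • y‖ ^ 2 ≤ 2 * ((2 / τ) * ‖x‖ ^ 2 + (τ / 2) * ‖y‖ ^ 2) := by
  have hsq : ‖x + (τ / 2) • y‖ ^ 2 ≤ 2 * (‖x‖ ^ 2 + (τ / 2 * ‖y‖) ^ 2) := by
    have hy : ‖(τ / 2) • y‖ = τ / 2 * ‖y‖ := norm_smul_of_nonneg (by positivity) y
    rw [← hy]
    calc ‖x + (τ / 2) • y‖ ^ 2 ≤ (‖x‖ + ‖(τ / 2) • y‖) ^ 2 := by gcongr; exact norm_add_le _ _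
      _ ≤ 2 * (‖x‖ ^ 2 + ‖(τ / 2) • y‖ ^ 2) := add_sq_le
  calc (2 / τ) * ‖x + (τ / 2) • y‖ ^ 2
      ≤ (2 / τ) * (2 * (‖x‖ ^ 2 + (τ / 2 * ‖y‖) ^ 2)) := by gcongr
    _ = 2 * ((2 / τ) * ‖x‖ ^ 2 + (τ / 2) * ‖y‖ ^ 2) := by field_simp

/-- Stability bound for the test functions `C = B + (τ/2) • curl E`,
`F = E + (τ/2) • grad p`, `q = p`:
`‖C‖_div² + ‖F‖_curl² + ‖q‖_grad² ≤ 4 (‖B‖_div² + ‖E‖_curl² + ‖p‖_grad²)`. -/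
theorem maxwell_aux_test_function_bound
    {VB VE VP L : Type*}
    [NormedAddCommGroup VB] [InnerProductSpace ℝ VB] [FiniteDimensional ℝ VB]
    [NormedAddCommGroup VE] [InnerProductSpace ℝ VE] [FiniteDimensional ℝ VE]
    [NormedAddCommGroup VP] [InnerProductSpace ℝ VP] [FiniteDimensional ℝ VP]
    [NormedAddCommGroup L] [InnerProductSpace ℝ L] [FiniteDimensional ℝ L]
    (curl : VE →ₗ[ℝ] VB) (grad : VP →ₗ[ℝ] VE) (dvg : VB →ₗ[ℝ] L)
    (hcg : ∀ p : VP, curl (grad p) = 0)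
    (hdc : ∀ E : VE, dvg (curl E) = 0)
    (z : VE →ₗ[ℝ] VE →ₗ[ℝ] ℝ)
    (hzsym : ∀ u v : VE, z u v = z v u)
    (hzpsd : ∀ u : VE, 0 ≤ z u u)
    (hzg : ∀ (E : VE) (p : VP), z E (grad p) = 0)
    (τ γ : ℝ) (hτ : 0 < τ) (hγ : 0 ≤ 1 + γ)
    (B : VB) (E : VE) (p : VP)
    (C : VB) (F : VE) (q : VP)
    (hC : C = B + (τ / 2) • curl E)
    (hF : F = E + (τ / 2) • grad p)
    (hq : q = p) :
    ((2 / τ) * ‖C‖ ^ 2 + ‖dvg C‖ ^ 2)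
      + ((2 / τ) * ‖F‖ ^ 2 + (τ / 2) * ‖curl F‖ ^ 2 + (1 + γ) * z F F)
      + ((2 / τ) * ‖q‖ ^ 2 + (τ / 2) * ‖grad q‖ ^ 2)
    ≤ 4 * (((2 / τ) * ‖B‖ ^ 2 + ‖dvg B‖ ^ 2)
        + ((2 / τ) * ‖E‖ ^ 2 + (τ / 2) * ‖curl E‖ ^ 2 + (1 + γ) * z E E)
        + ((2 / τ) * ‖p‖ ^ 2 + (τ / 2) * ‖grad p‖ ^ 2)) := by
  subst C F q
  have hdiv : dvg (B + (τ / 2) • curl E) = dvg B := by simp [hdc]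
  have hcurl : curl (E + (τ / 2) • grad p) = curl E := by simp [hcg]
  have hz : z (E + (τ / 2) • grad p) (E + (τ / 2) • grad p) = z E E := by
    simp [hzg, hzsym (grad p) E]
  rw [hdiv, hcurl, hz]
  have hB := two_div_mul_norm_add_smul_sq_le hτ B (curl E)
  have hE := two_div_mul_norm_add_smul_sq_le hτ E (grad p)
  have hzE : 0 ≤ (1 + γ) * z E E := mul_nonneg hγ (hzpsd E)
  have : 0 ≤ (2 / τ) * ‖B‖ ^ 2 := by positivity
  have : 0 ≤ (2 / τ) * ‖E‖ ^ 2 := by positivity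
  have : 0 ≤ (2 / τ) * ‖p‖ ^ 2 := by positivity
  have : 0 ≤ (τ / 2) * ‖curl E‖ ^ 2 := by positivity
  have : 0 ≤ (τ / 2) * ‖grad p‖ ^ 2 := by positivity
  have : 0 ≤ ‖dvg B‖ ^ 2 := by positivity
  linarith
end

section
/- (Inf-sup condition, Theorem 3.1) For every (B, E, p) ∈ V_B × V_E × V_p with (B,E,p) ≠ (0,0,0) there exists (C, F, q) ∈ V_B × V_E × V_p with (C,F,q) ≠ (0,0,0) such that a(B, E, p; C, F, q) ≥ (1/4)·(‖B‖_div² + ‖E‖_curl² + ‖p‖_grad²)^{1/2}·(‖C‖_div² + ‖F‖_curl² + ‖q‖_grad²)^{1/2}; in particular the bilinear form a satisfies the inf-sup condition with constant 1/4 in the weighted norms. -/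
open RealInnerProductSpace

/-- The weighted square of `x + (t / 2) • y`, expanded. -/
theorem weighted_norm_add_sq {V : Type*} [NormedAddCommGroup V] [InnerProductSpace ℝ V]
    {t : ℝ} (ht : t ≠ 0) (x y : V) :
    2 / t * ‖x + (t / 2) • y‖ ^ 2 = 2 / t * ‖x‖ ^ 2 + 2 * ⟪x, y⟫ + t / 2 * ‖y‖ ^ 2 := by
  rw [norm_add_sq_real, norm_smul, mul_pow, Real.norm_eq_abs, sq_abs, inner_smul_right]
  field_simp

/-- A weighted form of Young's inequality. -/
theorem weighted_young {V : Type*} [NormedAddCommGroup V] [InnerProductSpace ℝ V]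
    {t : ℝ} (ht : 0 < t) (x y : V) :
    2 * |⟪x, y⟫| ≤ 2 / t * ‖x‖ ^ 2 + t / 2 * ‖y‖ ^ 2 := by
  have hadd := weighted_norm_add_sq ht.ne' x y
  have hsub := weighted_norm_add_sq ht.ne' x (-y)
  rw [inner_neg_right, norm_neg] at hsub
  have h₁ : 0 ≤ 2 / t * ‖x + (t / 2) • y‖ ^ 2 := by positivity
  have h₂ : 0 ≤ 2 / t * ‖x + (t / 2) • -y‖ ^ 2 := by positivity
  rcases abs_cases ⟪x, y⟫ with h | h <;> linarith [h.1]

/-- If `m ≤ 4 n` and `n ≤ 2 a`, then `a` dominates a quarter of the geometric mean of `n, m`. -/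
theorem quarter_sqrt_mul_sqrt_le {a n m : ℝ} (hn : 0 ≤ n) (hm : m ≤ 4 * n) (ha : n ≤ 2 * a) :
    1 / 4 * √n * √m ≤ a := by
  have h : √m ≤ 2 * √n := by
    rw [Real.sqrt_le_left (by positivity), mul_pow, Real.sq_sqrt hn]
    linarith
  nlinarith [mul_le_mul_of_nonneg_left h (Real.sqrt_nonneg n), Real.mul_self_sqrt hn]

/-- Inf-sup condition (Theorem 3.1): for every nonzero `(B, E, p)` there is a
nonzero `(C, F, q)` with
`a(B,E,p;C,F,q) ≥ (1/4) (‖B‖_div² + ‖E‖_curl² + ‖p‖_grad²)^{1/2}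
  (‖C‖_div² + ‖F‖_curl² + ‖q‖_grad²)^{1/2}`. -/
theorem maxwell_aux_inf_sup
    {VB VE VP L : Type*}
    [NormedAddCommGroup VB] [InnerProductSpace ℝ VB] [FiniteDimensional ℝ VB]
    [NormedAddCommGroup VE] [InnerProductSpace ℝ VE] [FiniteDimensional ℝ VE]
    [NormedAddCommGroup VP] [InnerProductSpace ℝ VP] [FiniteDimensional ℝ VP]
    [NormedAddCommGroup L] [InnerProductSpace ℝ L] [FiniteDimensional ℝ L]
    (curl : VE →ₗ[ℝ] VB) (grad : VP →ₗ[ℝ] VE) (dvg : VB →ₗ[ℝ] L)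
    (hcg : ∀ p : VP, curl (grad p) = 0)
    (hdc : ∀ E : VE, dvg (curl E) = 0)
    (z : VE →ₗ[ℝ] VE →ₗ[ℝ] ℝ)
    (hzsym : ∀ u v : VE, z u v = z v u)
    (hzpsd : ∀ u : VE, 0 ≤ z u u)
    (hzg : ∀ (E : VE) (p : VP), z E (grad p) = 0)
    (τ γ : ℝ) (hτ : 0 < τ) (hγ : 0 ≤ 1 + γ)
    (B : VB) (E : VE) (p : VP)
    (hBEp : ¬(B = 0 ∧ E = 0 ∧ p = 0)) :
    ∃ (C : VB) (F : VE) (q : VP), ¬(C = 0 ∧ F = 0 ∧ q = 0) ∧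
      (2 / τ) * ⟪B, C⟫ + ⟪curl E, C⟫ + ⟪dvg B, dvg C⟫
        + (2 / τ) * ⟪E, F⟫ + ⟪grad p, F⟫ - ⟪B, curl F⟫ + (1 + γ) * z E F
        + (2 / τ) * ⟪p, q⟫ - ⟪E, grad q⟫
      ≥ (1 / 4) * Real.sqrt (((2 / τ) * ‖B‖ ^ 2 + ‖dvg B‖ ^ 2)
            + ((2 / τ) * ‖E‖ ^ 2 + (τ / 2) * ‖curl E‖ ^ 2 + (1 + γ) * z E E)
            + ((2 / τ) * ‖p‖ ^ 2 + (τ / 2) * ‖grad p‖ ^ 2))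
        * Real.sqrt (((2 / τ) * ‖C‖ ^ 2 + ‖dvg C‖ ^ 2)
            + ((2 / τ) * ‖F‖ ^ 2 + (τ / 2) * ‖curl F‖ ^ 2 + (1 + γ) * z F F)
            + ((2 / τ) * ‖q‖ ^ 2 + (τ / 2) * ‖grad q‖ ^ 2)) := by
  refine ⟨B + (τ / 2) • curl E, E + (τ / 2) • grad p, p, ?_, ?_⟩
  · rintro ⟨hC, hF, rfl⟩
    obtain rfl : E = 0 := by simpa using hF
    exact hBEp ⟨by simpa using hC, rfl, rfl⟩
  have hdiv : dvg (B + (τ / 2) • curl E) = dvg B := by simp [hdc]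
  have hcurl : curl (E + (τ / 2) • grad p) = curl E := by simp [hcg]
  have hz : z E (E + (τ / 2) • grad p) = z E E := by simp [hzg]
  have hzz : z (E + (τ / 2) • grad p) (E + (τ / 2) • grad p) = z E E := by
    rw [map_add, map_smul, hzg, smul_zero, add_zero, hzsym, hz]
  rw [hdiv, hcurl, hz, hzz]
  have hzE : 0 ≤ (1 + γ) * z E E := mul_nonneg hγ (hzpsd E)
  have hweight (u : ℝ) : 2 / τ * (τ / 2 * u) = u := by field_simp
  have hBc := weighted_young hτ B (curl E)
  have hEg := weighted_young hτ E (grad p)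
  have hBc_abs := abs_le.mp (le_refl |⟪B, curl E⟫|)
  have hEg_abs := abs_le.mp (le_refl |⟪E, grad p⟫|)
  have hB_nonneg : 0 ≤ 2 / τ * ‖B‖ ^ 2 := by positivity
  have hE_nonneg : 0 ≤ 2 / τ * ‖E‖ ^ 2 := by positivity
  have hp_nonneg : 0 ≤ 2 / τ * ‖p‖ ^ 2 := by positivity
  have hc_nonneg : 0 ≤ τ / 2 * ‖curl E‖ ^ 2 := by positivity
  have hg_nonneg : 0 ≤ τ / 2 * ‖grad p‖ ^ 2 := by positivity
  have hd_nonneg : 0 ≤ ‖dvg B‖ ^ 2 := by positivity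
  apply quarter_sqrt_mul_sqrt_le
  · positivity
  · rw [weighted_norm_add_sq hτ.ne', weighted_norm_add_sq hτ.ne']
    linarith
  · simp only [inner_add_right, inner_smul_right, real_inner_self_eq_norm_sq, mul_add, hweight,
      real_inner_comm B (curl E), real_inner_comm E (grad p)]
    linarith
end

section
/- (Boundedness, Theorem 3.1) The bilinear form a is bounded with respect to the weighted norms: for all B, C ∈ V_B, E, F ∈ V_E, p, q ∈ V_p, |a(B, E, p; C, F, q)| ≤ 4·(‖B‖_div² + ‖E‖_curl² + ‖p‖_grad²)^{1/2}·(‖C‖_div² + ‖F‖_curl² + ‖q‖_grad²)^{1/2}. -/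
open RealInnerProductSpace

theorem abs_weighted_inner_le {V : Type*} [NormedAddCommGroup V] [InnerProductSpace ℝ V]
    {c : ℝ} (hc : 0 ≤ c) (u v : V) : |c * ⟪u, v⟫| ≤ (√c * ‖u‖) * (√c * ‖v‖) := by
  rw [abs_mul, abs_of_nonneg hc, mul_mul_mul_comm, Real.mul_self_sqrt hc]
  exact mul_le_mul_of_nonneg_left (abs_real_inner_le_norm u v) hc

theorem abs_inner_le_of_mul_eq_one {V : Type*} [NormedAddCommGroup V] [InnerProductSpace ℝ V]
    {s t : ℝ} (hst : s * t = 1) (u v : V) : |⟪u, v⟫| ≤ (s * ‖u‖) * (t * ‖v‖) := by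
  rw [mul_mul_mul_comm, hst, one_mul]
  exact abs_real_inner_le_norm u v

/-- Boundedness (Theorem 3.1): the bilinear form `a` is bounded with respect to
the weighted norms, with constant `4`. -/
theorem maxwell_aux_boundedness
    {VB VE VP L : Type*}
    [NormedAddCommGroup VB] [InnerProductSpace ℝ VB] [FiniteDimensional ℝ VB]
    [NormedAddCommGroup VE] [InnerProductSpace ℝ VE] [FiniteDimensional ℝ VE]
    [NormedAddCommGroup VP] [InnerProductSpace ℝ VP] [FiniteDimensional ℝ VP]
    [NormedAddCommGroup L] [InnerProductSpace ℝ L] [FiniteDimensional ℝ L]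
    (curl : VE →ₗ[ℝ] VB) (grad : VP →ₗ[ℝ] VE) (dvg : VB →ₗ[ℝ] L)
    (hcg : ∀ p : VP, curl (grad p) = 0)
    (hdc : ∀ E : VE, dvg (curl E) = 0)
    (z : VE →ₗ[ℝ] VE →ₗ[ℝ] ℝ)
    (hzsym : ∀ u v : VE, z u v = z v u)
    (hzpsd : ∀ u : VE, 0 ≤ z u u)
    (hzg : ∀ (E : VE) (p : VP), z E (grad p) = 0)
    (τ γ : ℝ) (hτ : 0 < τ) (hγ : 0 ≤ 1 + γ)
    (B C : VB) (E F : VE) (p q : VP) :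
    |(2 / τ) * ⟪B, C⟫ + ⟪curl E, C⟫ + ⟪dvg B, dvg C⟫
        + (2 / τ) * ⟪E, F⟫ + ⟪grad p, F⟫ - ⟪B, curl F⟫ + (1 + γ) * z E F
        + (2 / τ) * ⟪p, q⟫ - ⟪E, grad q⟫|
      ≤ 4 * Real.sqrt (((2 / τ) * ‖B‖ ^ 2 + ‖dvg B‖ ^ 2)
            + ((2 / τ) * ‖E‖ ^ 2 + (τ / 2) * ‖curl E‖ ^ 2 + (1 + γ) * z E E)
            + ((2 / τ) * ‖p‖ ^ 2 + (τ / 2) * ‖grad p‖ ^ 2))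
        * Real.sqrt (((2 / τ) * ‖C‖ ^ 2 + ‖dvg C‖ ^ 2)
            + ((2 / τ) * ‖F‖ ^ 2 + (τ / 2) * ‖curl F‖ ^ 2 + (1 + γ) * z F F)
            + ((2 / τ) * ‖q‖ ^ 2 + (τ / 2) * ‖grad q‖ ^ 2)) := by
  have hc : 0 ≤ 2 / τ := by positivity
  have hd : 0 ≤ τ / 2 := by positivity
  have hcd : √(τ / 2) * √(2 / τ) = 1 := by
    rw [← Real.sqrt_mul hd, div_mul_div_cancel₀ two_ne_zero, div_self hτ.ne', Real.sqrt_one]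
  have hzE : 0 ≤ (1 + γ) * z E E := mul_nonneg hγ (hzpsd E)
  have hzF : 0 ≤ (1 + γ) * z F F := mul_nonneg hγ (hzpsd F)
  have hz : |(1 + γ) * z E F| ≤ √((1 + γ) * z E E) * √((1 + γ) * z F F) := by
    rw [← Real.sqrt_mul hzE]
    apply Real.abs_le_sqrt
    have h := LinearMap.BilinForm.apply_sq_le_of_symm z hzpsd ⟨hzsym⟩ E F
    calc ((1 + γ) * z E F) ^ 2 = (1 + γ) ^ 2 * z E F ^ 2 := by ring
      _ ≤ (1 + γ) ^ 2 * (z E E * z F F) := by gcongr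
      _ = _ := by ring
  have h₁ := abs_weighted_inner_le hc B C
  have h₂ := abs_inner_le_of_mul_eq_one hcd (curl E) C
  have h₃ := abs_real_inner_le_norm (dvg B) (dvg C)
  have h₄ := abs_weighted_inner_le hc E F
  have h₅ := abs_inner_le_of_mul_eq_one hcd (grad p) F
  have h₆ := abs_inner_le_of_mul_eq_one (mul_comm √(τ / 2) _ ▸ hcd) B (curl F)
  have h₇ := abs_weighted_inner_le hc p q
  have h₈ := abs_inner_le_of_mul_eq_one (mul_comm √(τ / 2) _ ▸ hcd) E (grad q)
  have hCS := Real.sum_mul_le_sqrt_mul_sqrt Finset.univ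
    ![√(2 / τ) * ‖B‖, √(τ / 2) * ‖curl E‖, ‖dvg B‖, √(2 / τ) * ‖E‖, √(τ / 2) * ‖grad p‖,
      √(2 / τ) * ‖B‖, √((1 + γ) * z E E), √(2 / τ) * ‖p‖, √(2 / τ) * ‖E‖]
    ![√(2 / τ) * ‖C‖, √(2 / τ) * ‖C‖, ‖dvg C‖, √(2 / τ) * ‖F‖, √(2 / τ) * ‖F‖,
      √(τ / 2) * ‖curl F‖, √((1 + γ) * z F F), √(2 / τ) * ‖q‖, √(τ / 2) * ‖grad q‖]
  simp only [Fin.sum_univ_succ, Fin.sum_univ_zero, Matrix.cons_val_zero, Matrix.cons_val_succ,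
    mul_pow, Real.sq_sqrt hc, Real.sq_sqrt hd, Real.sq_sqrt hzE, Real.sq_sqrt hzF] at hCS
  have hsqrt (x : ℝ) : √(2 ^ 2 * x) = 2 * √x := by
    rw [Real.sqrt_mul (by positivity), Real.sqrt_sq zero_le_two]
  rw [show (4 : ℝ) = 2 * 2 by norm_num, mul_assoc (2 * 2), mul_mul_mul_comm,
    ← hsqrt, ← hsqrt]
  refine le_trans ?_ (hCS.trans (mul_le_mul (Real.sqrt_le_sqrt ?_) (Real.sqrt_le_sqrt ?_)
    (Real.sqrt_nonneg _) (Real.sqrt_nonneg _)))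
  · rw [abs_le] at *
    constructor <;> linarith
  · have : 0 ≤ 2 / τ * ‖B‖ ^ 2 := by positivity
    have : 0 ≤ 2 / τ * ‖E‖ ^ 2 := by positivity
    have : 0 ≤ 2 / τ * ‖p‖ ^ 2 := by positivity
    have : 0 ≤ τ / 2 * ‖curl E‖ ^ 2 := by positivity
    have : 0 ≤ τ / 2 * ‖grad p‖ ^ 2 := by positivity
    linarith [sq_nonneg ‖dvg B‖]
  · have : 0 ≤ 2 / τ * ‖C‖ ^ 2 := by positivity
    have : 0 ≤ 2 / τ * ‖F‖ ^ 2 := by positivity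
    have : 0 ≤ 2 / τ * ‖q‖ ^ 2 := by positivity
    have : 0 ≤ τ / 2 * ‖curl F‖ ^ 2 := by positivity
    have : 0 ≤ τ / 2 * ‖grad q‖ ^ 2 := by positivity
    linarith [sq_nonneg ‖dvg C‖]
end

section
/- If D·K = 0, then the matrix Dᵀ·M₀·D + (2/τ)·M_B is invertible and (Dᵀ·M₀·D + (2/τ)·M_B)⁻¹ · M_B · K = (τ/2)·K = ((2/τ)·M_B)⁻¹ · M_B · K; i.e., removing the stabilization term Dᵀ M₀ D does not change the action of the first diagonal preconditioner block on the range of M_B K. -/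
open Matrix

/-- If `D * K = 0`, then `Dᵀ * M₀ * D + (2/τ) • M_B` is invertible and
`(Dᵀ * M₀ * D + (2/τ) • M_B)⁻¹ * (M_B * K) = (τ/2) • K = ((2/τ) • M_B)⁻¹ * (M_B * K)`:
removing the stabilization term does not change the action of the first diagonal
preconditioner block on the range of `M_B K`. -/
theorem stabilization_free_first_block
    {nB nE n0 : ℕ} (τ : ℝ) (hτ : 0 < τ)
    (MB : Matrix (Fin nB) (Fin nB) ℝ) (M0 : Matrix (Fin n0) (Fin n0) ℝ)
    (K : Matrix (Fin nB) (Fin nE) ℝ) (D : Matrix (Fin n0) (Fin nB) ℝ)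
    (hMB : MB.PosDef) (hM0 : M0.PosSemidef)
    (hDK : D * K = 0) :
    IsUnit (Dᵀ * M0 * D + (2 / τ) • MB) ∧
    (Dᵀ * M0 * D + (2 / τ) • MB)⁻¹ * (MB * K) = (τ / 2) • K ∧
    ((2 / τ) • MB)⁻¹ * (MB * K) = (τ / 2) • K := by
  have hS : ((2 / τ) • MB).PosDef := hMB.smul (by positivity)
  have hP : (Dᵀ * M0 * D).PosSemidef := by
    simpa only [conjTranspose_eq_transpose_of_trivial] using hM0.conjTranspose_mul_mul_same D
  have hA : (Dᵀ * M0 * D + (2 / τ) • MB).PosDef := PosDef.posSemidef_add hP hS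
  have hSK : ((2 / τ) • MB) * ((τ / 2) • K) = MB * K := by
    rw [smul_mul, Matrix.mul_smul, smul_smul, div_mul_div_cancel₀ hτ.ne',
      div_self two_ne_zero, one_smul]
  have hAK : (Dᵀ * M0 * D + (2 / τ) • MB) * ((τ / 2) • K) = MB * K := by
    rw [Matrix.add_mul, hSK, Matrix.mul_smul, Matrix.mul_assoc _ D K, hDK, Matrix.mul_zero,
      smul_zero, zero_add]
  refine ⟨hA.isUnit, ?_, ?_⟩
  · rw [← hAK, nonsing_inv_mul_cancel_left _ _ ((isUnit_iff_isUnit_det _).mp hA.isUnit)]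
  · rw [← hSK, nonsing_inv_mul_cancel_left _ _ ((isUnit_iff_isUnit_det _).mp hS.isUnit)]
end

section
/- For a real parameter ρ ≥ 0, the 4×4 real symmetric matrix [[1, −1/2, 0, 0], [−1/2, 1, −(1+ρ)/2, 0], [0, −(1+ρ)/2, 1, 0], [0, 0, 0, 1]] is positive definite if and only if ρ < √3 − 1. -/
open Matrix

/-- The quadratic form of the tridiagonal field-of-values matrix, as a sum of weighted squares. -/
lemma fov_matrix_quadratic_form (ρ : ℝ) (x : Fin 4 → ℝ) :
    star x ⬝ᵥ (!![(1 : ℝ), -1/2, 0, 0;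
        -1/2, 1, -(1+ρ)/2, 0;
        0, -(1+ρ)/2, 1, 0;
        0, 0, 0, 1] *ᵥ x) =
      (x 0 - x 1 / 2) ^ 2 + (x 2 - (1 + ρ) / 2 * x 1) ^ 2 +
        (3 - (1 + ρ) ^ 2) / 4 * x 1 ^ 2 + x 3 ^ 2 := by
  simp [dotProduct, mulVec, Fin.sum_univ_four]
  ring

/-- The 4×4 symmetric matrix of the field-of-values analysis (Theorem 4.3) is
positive definite if and only if `ρ < √3 - 1` (for `ρ ≥ 0`). -/
theorem fov_matrix_posDef_iff (ρ : ℝ) (hρ : 0 ≤ ρ) :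
    (!![(1 : ℝ), -1/2, 0, 0;
        -1/2, 1, -(1+ρ)/2, 0;
        0, -(1+ρ)/2, 1, 0;
        0, 0, 0, 1]).PosDef ↔ ρ < Real.sqrt 3 - 1 := by
  rw [lt_sub_iff_add_lt, add_comm ρ 1, Real.lt_sqrt (by positivity)]
  constructor
  · intro h
    have hx : (![1 / 2, 1, (1 + ρ) / 2, 0] : Fin 4 → ℝ) ≠ 0 := fun h0 => by
      simpa using congrFun h0 1
    have hpos := h.dotProduct_mulVec_pos hx
    rw [fov_matrix_quadratic_form] at hpos
    simp at hpos
    linarith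
  · intro h
    refine .of_dotProduct_mulVec_pos ?_ fun x hx => ?_
    · ext i j
      fin_cases i <;> fin_cases j <;> simp
    · rw [fov_matrix_quadratic_form]
      have hc : 0 < (3 - (1 + ρ) ^ 2) / 4 := by linarith
      by_cases h1 : x 1 = 0
      · have hne : x 0 ≠ 0 ∨ x 2 ≠ 0 ∨ x 3 ≠ 0 := by
          by_contra! h0
          apply hx
          ext i
          fin_cases i <;> simp [h0, h1]
        simp only [h1]
        ring_nf
        rcases hne with h0 | h0 | h0 <;> positivity
      · positivity
end

section
/- For every real ρ with 0 ≤ ρ < √3 − 1 there exists a constant λ₀ > 0 such that for all real numbers b, e, g, s: b² − b·e + e² − (1+ρ)·e·g + g² + s² ≥ λ₀·(b² + e² + g² + s²). -/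
/-- Quadratic-form coercivity estimate at the core of the field-of-values bound
(Theorem 4.3): for `0 ≤ ρ < √3 - 1` there is `λ₀ > 0` with
`b² - b e + e² - (1+ρ) e g + g² + s² ≥ λ₀ (b² + e² + g² + s²)` for all reals. -/
theorem fov_quadratic_coercivity (ρ : ℝ) (hρ0 : 0 ≤ ρ) (hρ : ρ < Real.sqrt 3 - 1) :
    ∃ lam0 : ℝ, 0 < lam0 ∧ ∀ b e g s : ℝ,
      b ^ 2 - b * e + e ^ 2 - (1 + ρ) * e * g + g ^ 2 + s ^ 2
        ≥ lam0 * (b ^ 2 + e ^ 2 + g ^ 2 + s ^ 2) := by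
  set t := √(1 + (1 + ρ) ^ 2)
  have ht2 : t ^ 2 = 1 + (1 + ρ) ^ 2 := Real.sq_sqrt (by positivity)
  have ht : 0 < t := Real.sqrt_pos.2 (by positivity)
  have hr : (1 + ρ) ^ 2 < 3 := (Real.lt_sqrt (by linarith)).1 (by linarith)
  have ht_lt : t < 2 := by nlinarith
  refine ⟨1 - t / 2, by linarith, fun b e g s => ?_⟩
  have key : 2 * (e * (b + (1 + ρ) * g)) ≤ t * (b ^ 2 + e ^ 2 + g ^ 2) := by
    refine le_of_mul_le_mul_left ?_ ht
    have hsq : t * (t * (b ^ 2 + e ^ 2 + g ^ 2)) - t * (2 * (e * (b + (1 + ρ) * g))) =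
        (t * e - (b + (1 + ρ) * g)) ^ 2 + ((1 + ρ) * b - g) ^ 2 := by
      linear_combination (b ^ 2 + g ^ 2) * ht2
    linarith [sq_nonneg (t * e - (b + (1 + ρ) * g)), sq_nonneg ((1 + ρ) * b - g)]
  linarith [mul_nonneg ht.le (sq_nonneg s)]
end
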